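/- arXiv:2403.13572 — 4 statements merged into one kernel-verified Lean document; each statement's English description precedes it below -/
import Mathlib

section
/- Let H be a complex Hilbert space and π : ℝ → B(H) a strongly continuous representation of ℝ on H by bounded invertible operators. Let ε > 0 and let v ∈ H be a smooth vector, i.e. the orbit map t ↦ π(t)v is C^∞ from ℝ to H. Suppose there exists a function F : ℂ × ℂ → ℂ that is holomorphic on S_ε × S_ε and satisfies F(s,t) = ⟨π(s)v, π(t)v⟩ for all real s, t. Then the orbit map extends holomorphically to the strip: there exists g : ℂ → H holomorphic on S_ε with g(t) = π(t)v for all real t. -/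
open scoped InnerProductSpace

open Filter Topology MeasureTheory Metric in
theorem differentiableOn_intervalIntegral_of_continuousOn {U : Set ℂ} (hU : IsOpen U)
    {Φ : ℂ → ℝ → ℂ} (hd : ∀ θ, DifferentiableOn ℂ (fun z => Φ z θ) U)
    (hc : ContinuousOn (fun p : ℂ × ℝ => Φ p.1 p.2) (U ×ˢ Set.univ)) (a b : ℝ) :
    DifferentiableOn ℂ (fun z => ∫ θ in a..b, Φ z θ) U := by
  intro z₀ hz₀
  obtain ⟨r, hr, hrU⟩ := nhds_basis_closedBall.mem_iff.1 (hU.mem_nhds hz₀)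
  have hcont : ∀ z ∈ U, Continuous (Φ z) := fun z hz =>
    hc.comp_continuous (f := fun θ : ℝ => (z, θ)) (by fun_prop) (fun θ => ⟨hz, trivial⟩)
  obtain ⟨C, hC⟩ := ((isCompact_closedBall z₀ r).prod (isCompact_uIcc (a := a) (b := b))
    ).exists_bound_of_continuousOn (hc.mono (Set.prod_mono hrU (Set.subset_univ _)))
  have hhalf : ∀ x ∈ ball z₀ (r / 2), closedBall x (r / 2) ⊆ closedBall z₀ r := fun x hx =>
    closedBall_subset_closedBall' (by have := mem_ball.1 hx; linarith)
  have hderiv : ∀ θ, ∀ x ∈ U, HasDerivAt (fun z => Φ z θ) (deriv (fun z => Φ z θ) x) x :=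
    fun θ x hx => ((hd θ).differentiableAt (hU.mem_nhds hx)).hasDerivAt
  refine (intervalIntegral.hasDerivAt_integral_of_dominated_loc_of_deriv_le
    (F' := fun z θ => deriv (fun z => Φ z θ) z) (bound := fun _ => C / (r / 2))
    (s := ball z₀ (r / 2)) (ball_mem_nhds _ (by positivity)) ?_ ?_ ?_ ?_ ?_ ?_
    ).2.differentiableAt.differentiableWithinAt
  · filter_upwards [hU.mem_nhds hz₀] with x hx using (hcont x hx).aestronglyMeasurable
  · exact (hcont z₀ hz₀).intervalIntegrable _ _
  · have hseq : Tendsto (fun n : ℕ => ((r / (n + 1) : ℝ) : ℂ)) atTop (𝓝[≠] 0) := by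
      refine tendsto_nhdsWithin_iff.2 ⟨?_, Eventually.of_forall fun n => ?_⟩
      · have := (tendsto_const_div_atTop_nhds_zero_nat r).comp (tendsto_add_atTop_nat 1)
        rw [← Complex.ofReal_zero]
        refine (Complex.continuous_ofReal.tendsto 0).comp ?_
        simpa [Function.comp_def] using this
      · have : r / ((n : ℝ) + 1) ≠ 0 := by positivity
        simpa using Complex.ofReal_ne_zero.2 this
    refine aestronglyMeasurable_of_tendsto_ae atTop
      (f := fun (n : ℕ) θ => ((r / (n + 1) : ℝ) : ℂ)⁻¹ •
        (Φ (z₀ + ((r / (n + 1) : ℝ) : ℂ)) θ - Φ z₀ θ)) (fun n => ?_)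
      (ae_of_all _ fun θ => ((hderiv θ z₀ hz₀).tendsto_slope_zero).comp hseq)
    have hmem : z₀ + ((r / (n + 1) : ℝ) : ℂ) ∈ U := hrU <| by
      rw [mem_closedBall, dist_self_add_left, Complex.norm_real, Real.norm_of_nonneg (by positivity)]
      exact div_le_self hr.le (by simp)
    have hdiff : Continuous fun θ => Φ (z₀ + ((r / (n + 1) : ℝ) : ℂ)) θ - Φ z₀ θ :=
      (hcont _ hmem).sub (hcont z₀ hz₀)
    exact (hdiff.const_smul ((r / (n + 1) : ℝ) : ℂ)⁻¹).aestronglyMeasurable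
  · refine ae_of_all _ fun θ hθ x hx => ?_
    refine Complex.norm_deriv_le_of_forall_mem_sphere_norm_le (by positivity)
      ((hd θ).diffContOnCl_ball ((hhalf x hx).trans hrU)) fun z hz => ?_
    exact hC (z, θ) ⟨hhalf x hx (sphere_subset_closedBall hz), Set.uIoc_subset_uIcc hθ⟩
  · exact intervalIntegrable_const
  · refine ae_of_all _ fun θ _ x hx => hderiv θ x (hrU (hhalf x hx (mem_closedBall_self ?_)))
    positivity

open Metric in
theorem differentiableOn_iteratedDeriv_snd {U V : Set ℂ} (hU : IsOpen U) (hV : IsOpen V)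
    {F : ℂ × ℂ → ℂ} (hF : DifferentiableOn ℂ F (U ×ˢ V)) (n : ℕ) {w₀ : ℂ} (hw₀ : w₀ ∈ V) :
    DifferentiableOn ℂ (fun z => iteratedDeriv n (fun w => F (z, w)) w₀) U := by
  obtain ⟨r, hr, hrV⟩ := nhds_basis_closedBall.mem_iff.1 (hV.mem_nhds hw₀)
  have hcirc : ∀ θ, circleMap w₀ r θ ∈ V := fun θ => hrV (circleMap_mem_closedBall _ hr.le θ)
  have hsub : ∀ θ, circleMap w₀ r θ - w₀ ≠ 0 := fun θ => by simp [circleMap, hr.ne']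
  have key : DifferentiableOn ℂ (fun z => ∫ θ in (0 : ℝ)..2 * Real.pi, deriv (circleMap w₀ r) θ •
      ((1 / (circleMap w₀ r θ - w₀) ^ (n + 1)) • F (z, circleMap w₀ r θ))) U := by
    refine differentiableOn_intervalIntegral_of_continuousOn hU (fun θ => ?_) ?_ _ _
    · have hFθ : DifferentiableOn ℂ (fun z => F (z, circleMap w₀ r θ)) U :=
        hF.comp (by fun_prop) fun z hz => ⟨hz, hcirc θ⟩
      exact (hFθ.fun_const_smul (1 / (circleMap w₀ r θ - w₀) ^ (n + 1))).fun_const_smul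
        (deriv (circleMap w₀ r) θ)
    · refine ContinuousOn.fun_smul ?_ (ContinuousOn.fun_smul ?_ ?_)
      · simp only [deriv_circleMap]
        fun_prop
      · refine Continuous.continuousOn (Continuous.div (by fun_prop) (by fun_prop) fun p => ?_)
        exact pow_ne_zero _ (hsub _)
      · exact hF.continuousOn.comp (f := fun p : ℂ × ℝ => (p.1, circleMap w₀ r p.2))
          (by fun_prop) fun p hp => ⟨hp.1, hcirc _⟩
  refine (key.const_smul (2 * Real.pi * Complex.I / n.factorial : ℂ)⁻¹).congr fun z hz => ?_
  have hdiff : DiffContOnCl ℂ (fun w => F (z, w)) (ball w₀ r) :=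
    DifferentiableOn.diffContOnCl_ball (U := V) (hF.comp (by fun_prop) fun w hw => ⟨hz, hw⟩) hrV
  have h := DiffContOnCl.circleIntegral_one_div_sub_center_pow_smul hr n hdiff
  have hne : (2 * Real.pi * Complex.I / n.factorial : ℂ) ≠ 0 := by
    simp [Nat.factorial_ne_zero, Real.pi_ne_zero]
  rw [circleIntegral] at h
  rw [Pi.smul_apply, h, inv_smul_smul₀ hne]

theorem iteratedDeriv_ofReal_eq {U : Set ℂ} (hU : IsOpen U) (hreal : ∀ t : ℝ, (t : ℂ) ∈ U)
    {f : ℂ → ℂ} (hf : DifferentiableOn ℂ f U) {φ : ℕ → ℝ → ℂ}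
    (hφ : ∀ n t, HasDerivAt (φ n) (φ (n + 1) t) t) (h0 : ∀ t : ℝ, f t = φ 0 t) (n : ℕ) (t : ℝ) :
    iteratedDeriv n f t = φ n t := by
  induction n generalizing t with
  | zero => simpa using h0 t
  | succ n ih =>
    have hd : DifferentiableAt ℂ (iteratedDeriv n f) t :=
      ((hf.analyticOnNhd hU).iterated_deriv n t (hreal t)).differentiableAt |>.congr_of_eventuallyEq
        (by rw [iteratedDeriv_eq_iterate])
    have h1 : HasDerivAt (φ n) (iteratedDeriv (n + 1) f t) t := by
      rw [iteratedDeriv_succ, ← funext ih]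
      exact hd.hasDerivAt.comp_ofReal
    exact h1.unique (hφ n t)

section DerivativeSequence

variable {H : Type*} [NormedAddCommGroup H] [InnerProductSpace ℂ H]

theorem inner_derivative_sequence_eq_zero {γ : ℕ → ℝ → H}
    (hγ : ∀ n t, HasDerivAt (γ n) (γ (n + 1) t) t) {d : H} (hd : ∀ t, ⟪d, γ 0 t⟫_ℂ = 0)
    (n : ℕ) (t : ℝ) : ⟪d, γ n t⟫_ℂ = 0 := by
  induction n generalizing t with
  | zero => exact hd t
  | succ n ih =>
    have h : HasDerivAt (fun t => ⟪d, γ n t⟫_ℂ) ⟪d, γ (n + 1) t⟫_ℂ t := by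
      simpa using (hasDerivAt_const t d).inner ℂ (hγ n t)
    rw [funext ih] at h
    exact h.unique (hasDerivAt_const t 0)

open Metric in
theorem exists_norm_derivative_sequence_le {γ : ℕ → ℝ → H}
    (hγ : ∀ n t, HasDerivAt (γ n) (γ (n + 1) t) t) {U : Set ℂ} (hU : IsOpen U)
    (hreal : ∀ t : ℝ, (t : ℂ) ∈ U) {F : ℂ × ℂ → ℂ} (hF : DifferentiableOn ℂ F (U ×ˢ U))
    (hFeq : ∀ s t : ℝ, F (s, t) = ⟪γ 0 s, γ 0 t⟫_ℂ) {t : ℝ} {r : ℝ} (hr : 0 < r)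
    (hrU : closedBall (t : ℂ) r ⊆ U) :
    ∃ C : ℝ, ∀ n, ‖γ n t‖ ≤ C * n.factorial / r ^ n := by
  obtain ⟨C, hC⟩ := ((isCompact_closedBall (t : ℂ) r).prod (isCompact_closedBall (t : ℂ) r)
    ).exists_bound_of_continuousOn (hF.continuousOn.mono (Set.prod_mono hrU hrU))
  have hC0 : 0 ≤ C := (norm_nonneg _).trans
    (hC ((t : ℂ), (t : ℂ)) ⟨mem_closedBall_self hr.le, mem_closedBall_self hr.le⟩)
  refine ⟨√C, fun n => ?_⟩
  have hsnd : ∀ z ∈ U, DifferentiableOn ℂ (fun w => F (z, w)) U := fun z hz =>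
    hF.comp (by fun_prop) fun w hw => ⟨hz, hw⟩
  have hG := differentiableOn_iteratedDeriv_snd hU hU hF n (hreal t)
  have hG_real : ∀ s : ℝ, iteratedDeriv n (fun w => F (s, w)) t = ⟪γ 0 s, γ n t⟫_ℂ := fun s =>
    iteratedDeriv_ofReal_eq hU hreal (hsnd s (hreal s)) (φ := fun m t => ⟪γ 0 s, γ m t⟫_ℂ)
      (fun m t => by simpa using (hasDerivAt_const t (γ 0 s)).inner ℂ (hγ m t)) (hFeq s) n t
  have hG_bound : ∀ z ∈ sphere (t : ℂ) r,
      ‖iteratedDeriv n (fun w => F (z, w)) t‖ ≤ n.factorial * C / r ^ n := fun z hz =>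
    Complex.norm_iteratedDeriv_le_of_forall_mem_sphere_norm_le n hr
      ((hsnd z (hrU (sphere_subset_closedBall hz))).diffContOnCl_ball hrU) fun w hw =>
        hC (z, w) ⟨sphere_subset_closedBall hz, sphere_subset_closedBall hw⟩
  have hbound := Complex.norm_iteratedDeriv_le_of_forall_mem_sphere_norm_le n hr
    (hG.diffContOnCl_ball hrU) hG_bound
  rw [iteratedDeriv_ofReal_eq hU hreal hG (φ := fun m s => ⟪γ m s, γ n t⟫_ℂ)
      (fun m s => by simpa using (hγ m s).inner ℂ (hasDerivAt_const s (γ n t))) hG_real n t,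
    inner_self_eq_norm_sq_to_K, norm_pow, RCLike.norm_ofReal, abs_norm] at hbound
  refine le_of_sq_le_sq ?_ (by positivity)
  refine hbound.trans_eq ?_
  rw [div_pow, mul_pow, Real.sq_sqrt hC0]
  ring

variable [CompleteSpace H]

open Metric in
theorem exists_differentiableOn_extension_of_kernel {γ : ℕ → ℝ → H}
    (hγ : ∀ n t, HasDerivAt (γ n) (γ (n + 1) t) t) {ε : ℝ} (hε : 0 < ε) {F : ℂ × ℂ → ℂ}
    (hF : DifferentiableOn ℂ F ({z : ℂ | |z.im| < ε} ×ˢ {z : ℂ | |z.im| < ε}))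
    (hFeq : ∀ s t : ℝ, F (s, t) = ⟪γ 0 s, γ 0 t⟫_ℂ) :
    ∃ g : ℂ → H, DifferentiableOn ℂ g {z : ℂ | |z.im| < ε} ∧ ∀ t : ℝ, g t = γ 0 t := by
  set U : Set ℂ := {z : ℂ | |z.im| < ε} with hU_def
  have hU : IsOpen U := isOpen_lt (by fun_prop) continuous_const
  have hreal : ∀ t : ℝ, (t : ℂ) ∈ U := fun t => by simpa [hU_def] using hε
  have hball : ∀ t : ℝ, ball (t : ℂ) ε ⊆ U := fun t z hz => by
    have h := (Complex.abs_im_le_norm (z - t)).trans_lt (mem_ball_iff_norm.1 hz)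
    simpa [hU_def] using h
  have hball_re : ∀ z ∈ U, z ∈ ball (z.re : ℂ) ε := fun z hz => by
    rw [mem_ball_iff_norm]
    have : z - z.re = z.im * Complex.I := by
      nth_rewrite 1 [← Complex.re_add_im z]
      ring
    simpa [this, hU_def] using hz
  set T : ℝ → ℂ → ℕ → H := fun t z n => ((n.factorial : ℂ)⁻¹ * (z - t) ^ n) • γ n t with hT
  have hT_bound : ∀ t : ℝ, ∀ r < ε, ∃ u : ℕ → ℝ, Summable u ∧
      ∀ n, ∀ z ∈ ball (t : ℂ) r, ‖T t z n‖ ≤ u n := by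
    intro t r hr
    obtain hr0 | hr0 := le_or_gt r 0
    · exact ⟨0, summable_zero, fun n z hz => by simp [ball_eq_empty.2 hr0] at hz⟩
    obtain ⟨R, hrR, hRε⟩ := exists_between hr
    have hR : 0 < R := hr0.trans hrR
    obtain ⟨C, hC⟩ := exists_norm_derivative_sequence_le hγ hU hreal hF hFeq hR
      ((closedBall_subset_ball hRε).trans (hball t))
    refine ⟨fun n => C * (r / R) ^ n, (summable_geometric_of_lt_one (by positivity)
      ((div_lt_one hR).2 hrR)).mul_left C, fun n z hz => ?_⟩
    have hz' : ‖z - t‖ ≤ r := (mem_ball_iff_norm.1 hz).le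
    calc ‖T t z n‖ = (n.factorial : ℝ)⁻¹ * ‖z - t‖ ^ n * ‖γ n t‖ := by simp [hT, norm_smul]
      _ ≤ (n.factorial : ℝ)⁻¹ * r ^ n * (C * n.factorial / R ^ n) := by
        gcongr
        exact hC n
      _ = C * (r / R) ^ n := by
        have : (n.factorial : ℝ) ≠ 0 := by positivity
        rw [div_pow]
        field_simp
  have hT_summable : ∀ t : ℝ, ∀ z ∈ ball (t : ℂ) ε, Summable (T t z) := fun t z hz => by
    obtain ⟨r, hzr, hr⟩ := exists_between (mem_ball.1 hz)
    obtain ⟨u, hu, hTu⟩ := hT_bound t r hr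
    exact hu.of_norm_bounded fun n => hTu n z (mem_ball.2 hzr)
  have hT_diff : ∀ t : ℝ, ∀ z ∈ ball (t : ℂ) ε, DifferentiableAt ℂ (fun z => ∑' n, T t z n) z :=
    fun t z hz => by
    obtain ⟨r, hzr, hr⟩ := exists_between (mem_ball.1 hz)
    obtain ⟨u, hu, hTu⟩ := hT_bound t r hr
    exact (Complex.differentiableOn_tsum_of_summable_norm hu (fun n => by fun_prop) isOpen_ball
      hTu).differentiableAt (isOpen_ball.mem_nhds (mem_ball.2 hzr))
  have hT_inner : ∀ s t : ℝ, ∀ z ∈ ball (t : ℂ) ε, ⟪γ 0 s, ∑' n, T t z n⟫_ℂ = F (s, z) := by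
    intro s t z hz
    have hFs : DifferentiableOn ℂ (fun w => F (s, w)) U :=
      hF.comp (by fun_prop) fun w hw => ⟨hreal s, hw⟩
    have h1 := (hT_summable t z hz).hasSum.mapL (innerSL ℂ (γ 0 s))
    have h2 := Complex.hasSum_taylorSeries_on_ball (hFs.mono (hball t)) hz
    have h3 : ∀ n, innerSL ℂ (γ 0 s) (T t z n) = (n.factorial : ℂ)⁻¹ • (z - t) ^ n •
        iteratedDeriv n (fun w => F (s, w)) t := fun n => by
      rw [iteratedDeriv_ofReal_eq hU hreal hFs (φ := fun m t => ⟪γ 0 s, γ m t⟫_ℂ)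
        (fun m t => by simpa using (hasDerivAt_const t (γ 0 s)).inner ℂ (hγ m t)) (hFeq s) n t]
      simp [hT, mul_assoc]
    rw [funext h3] at h1
    exact h1.unique h2
  have hT_perp : ∀ (t : ℝ) (z : ℂ), z ∈ ball (t : ℂ) ε → ∀ d : H, (∀ s, ⟪d, γ 0 s⟫_ℂ = 0) →
      ⟪d, ∑' n, T t z n⟫_ℂ = 0 := by
    intro t z hz d hd
    rw [← innerSL_apply_apply, (innerSL ℂ d).map_tsum (hT_summable t z hz)]
    simp [hT, inner_derivative_sequence_eq_zero hγ hd]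
  have hT_unique : ∀ (t t' : ℝ) (z : ℂ), z ∈ ball (t : ℂ) ε → z ∈ ball (t' : ℂ) ε →
      ∑' n, T t z n = ∑' n, T t' z n := by
    intro t t' z hz hz'
    have hd : ∀ s, ⟪∑' n, T t z n - ∑' n, T t' z n, γ 0 s⟫_ℂ = 0 := fun s => by
      rw [← inner_conj_symm, inner_sub_right, hT_inner s t z hz, hT_inner s t' z hz', sub_self,
        map_zero]
    rw [← sub_eq_zero, ← inner_self_eq_zero (𝕜 := ℂ), inner_sub_right, hT_perp t z hz _ hd,
      hT_perp t' z hz' _ hd, sub_zero]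
  refine ⟨fun z => ∑' n, T z.re z n, fun z hz => ?_, fun t => ?_⟩
  · refine ((hT_diff z.re z (hball_re z hz)).congr_of_eventuallyEq ?_).differentiableWithinAt
    filter_upwards [isOpen_ball.mem_nhds (hball_re z hz)] with w hw
    exact hT_unique _ _ w (hball_re w (hball _ hw)) hw
  · refine (tsum_eq_single 0 fun n hn => ?_).trans ?_
    · simp [hT, hn]
    · simp [hT]

end DerivativeSequence

/-- If the matrix-coefficient kernel `(s, t) ↦ ⟨π(s)v, π(t)v⟩` of a smooth
vector `v` for a strongly continuous representation `π` of `ℝ` on a Hilbert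
space extends holomorphically to `S_ε × S_ε` (where `S_ε` is the open strip of
half-width `ε`), then the orbit map `t ↦ π(t)v` extends holomorphically to the
strip `S_ε`. -/
theorem orbit_map_extends_of_kernel_extends
    {H : Type*} [NormedAddCommGroup H] [InnerProductSpace ℂ H] [CompleteSpace H]
    (π : ℝ → H →L[ℂ] H)
    (hπ0 : π 0 = 1)
    (hπadd : ∀ s t : ℝ, π (s + t) = π s ∘L π t)
    (hπinv : ∀ t : ℝ, IsUnit (π t))
    (hπcont : ∀ w : H, Continuous fun t : ℝ => π t w)
    (ε : ℝ) (hε : 0 < ε) (v : H)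
    (hv : ContDiff ℝ (⊤ : ℕ∞) fun t : ℝ => π t v)
    (F : ℂ × ℂ → ℂ)
    (hF : DifferentiableOn ℂ F
      ({z : ℂ | |z.im| < ε} ×ˢ {z : ℂ | |z.im| < ε}))
    (hFeq : ∀ s t : ℝ, F (s, t) = ⟪π s v, π t v⟫_ℂ) :
    ∃ g : ℂ → H, DifferentiableOn ℂ g {z : ℂ | |z.im| < ε} ∧
      ∀ t : ℝ, g t = π t v := by
  refine exists_differentiableOn_extension_of_kernel
    (γ := fun n => iteratedDeriv n fun t : ℝ => π t v) (fun n t => ?_) hε hF (by simpa using hFeq)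
    |>.imp fun g hg => by simpa using hg
  rw [iteratedDeriv_succ]
  exact (hv.differentiable_iteratedDeriv n (by exact_mod_cast WithTop.coe_lt_top n) t).hasDerivAt
end

section
/- Let X be a complex Banach space, π : ℝ → B(X) a strongly continuous representation of ℝ on X by bounded invertible operators, β > 0, C > 0 and N a natural number. Let v ∈ X and suppose g : ℂ → X is holomorphic on the strip S_β with g(t) = π(t)v for all real t, and that ‖g(it)‖ ≤ C·(β − |t|)^{−N} for all |t| < β. Then for every natural number k there is a constant C_k > 0 such that the k-th complex derivative of g satisfies ‖g^{(k)}(it)‖ ≤ C_k · k! · (β − |t|)^{−(N+k)} for all |t| < β. (That is, a vector of slow growth of order N has derivatives of slow growth of order N + k.) -/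
open Filter Topology in
/-- A strongly continuous one-parameter group on a normed space is bounded near `0`. Completeness
is not needed: the Baire category theorem is applied to `ℝ`. -/
theorem exists_norm_le_near_zero_of_strongly_continuous
    {X : Type*} [NormedAddCommGroup X] [NormedSpace ℂ X] (π : ℝ → X →L[ℂ] X)
    (hπadd : ∀ s t : ℝ, π (s + t) = π s ∘L π t)
    (hπcont : ∀ w : X, Continuous fun t : ℝ => π t w) :
    ∃ r > 0, ∃ M > 0, ∀ s : ℝ, |s| ≤ r → ‖π s‖ ≤ M := by
  have hclosed : ∀ n : ℕ, IsClosed {s : ℝ | ‖π s‖ ≤ n} := by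
    intro n
    have : {s : ℝ | ‖π s‖ ≤ n} = ⋂ w : X, {s : ℝ | ‖π s w‖ ≤ n * ‖w‖} := by
      ext s
      simp [ContinuousLinearMap.opNorm_le_iff (Nat.cast_nonneg (α := ℝ) n)]
    rw [this]
    exact isClosed_iInter fun w => isClosed_le (hπcont w).norm continuous_const
  obtain ⟨n, a, ha⟩ := nonempty_interior_of_iUnion_of_closed hclosed
    (Set.eq_univ_of_forall fun s => Set.mem_iUnion.2 (exists_nat_ge ‖π s‖))
  obtain ⟨ε, hε, hball⟩ := Metric.isOpen_iff.1 isOpen_interior a ha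
  refine ⟨ε / 2, half_pos hε, n * ‖π (-a)‖ + 1, by positivity, fun s hs => ?_⟩
  have hmem : a + s ∈ {s : ℝ | ‖π s‖ ≤ n} := by
    refine interior_subset (hball ?_)
    rw [Metric.mem_ball, Real.dist_eq, add_sub_cancel_left]
    linarith
  have hs' : π s = π (a + s) ∘L π (-a) := by
    rw [← hπadd]
    congr 1
    ring
  calc ‖π s‖ ≤ ‖π (a + s)‖ * ‖π (-a)‖ := by
        rw [hs']
        exact ContinuousLinearMap.opNorm_comp_le _ _
    _ ≤ n * ‖π (-a)‖ + 1 := by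
        have := mul_le_mul_of_nonneg_right hmem (norm_nonneg (π (-a)))
        linarith

theorem isOpen_abs_im_lt (β : ℝ) : IsOpen {z : ℂ | |z.im| < β} :=
  isOpen_lt (by fun_prop) continuous_const

theorem convex_abs_im_lt (β : ℝ) : Convex ℝ {z : ℂ | |z.im| < β} := by
  have : {z : ℂ | |z.im| < β} = Complex.imLm ⁻¹' Set.Ioo (-β) β := by
    ext z
    simp [abs_lt]
  rw [this]
  exact (convex_Ioo _ _).linear_preimage _

open Filter Topology in
/-- Two holomorphic functions on a strip, valued in a possibly incomplete normed space, agree as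
soon as they agree on the real line. -/
theorem DifferentiableOn.eqOn_strip_of_eq_real
    {X : Type*} [NormedAddCommGroup X] [NormedSpace ℂ X] {β : ℝ} (hβ : 0 < β) {f g : ℂ → X}
    (hf : DifferentiableOn ℂ f {z : ℂ | |z.im| < β})
    (hg : DifferentiableOn ℂ g {z : ℂ | |z.im| < β})
    (hfg : ∀ t : ℝ, f t = g t) : Set.EqOn f g {z : ℂ | |z.im| < β} := by
  let ι : X →L[ℂ] UniformSpace.Completion X := UniformSpace.Completion.toComplL
  have hι : Function.Injective ι := UniformSpace.Completion.coe_injective X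
  have han : ∀ {h : ℂ → X}, DifferentiableOn ℂ h {z : ℂ | |z.im| < β} →
      AnalyticOnNhd ℂ (fun z => ι (h z)) {z : ℂ | |z.im| < β} := fun hh =>
    (ι.differentiable.comp_differentiableOn hh).analyticOnNhd (isOpen_abs_im_lt β)
  have hfreq : ∃ᶠ z in 𝓝[≠] (0 : ℂ), ι (f z) = ι (g z) := by
    have hreal : ∀ᶠ t : ℝ in 𝓝[≠] (0 : ℝ), ι (f t) = ι (g t) :=
      Eventually.of_forall fun t => by rw [hfg]
    have htend : Tendsto (fun t : ℝ => (t : ℂ)) (𝓝[≠] 0) (𝓝[≠] 0) := by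
      refine tendsto_nhdsWithin_iff.2 ⟨?_, ?_⟩
      · exact (Complex.continuous_ofReal.tendsto' 0 0 Complex.ofReal_zero).mono_left
          nhdsWithin_le_nhds
      · filter_upwards [self_mem_nhdsWithin] with t ht
        simpa using ht
    exact htend.frequently hreal.frequently
  intro z hz
  exact hι ((han hf).eqOn_of_preconnected_of_frequently_eq (han hg)
    (convex_abs_im_lt β).isPreconnected (by simpa using hβ) hfreq hz)

open Filter Topology in
/-- The derivative of a function whose values near `z` are either `0` or those of `G` is, at `z`,
either `0` or the derivative of `G`. -/
theorem HasDerivAt.eq_zero_or_eq_of_eventually_eq_zero_or_eq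
    {Y : Type*} [NormedAddCommGroup Y] [NormedSpace ℂ Y] {h G : ℂ → Y} {D D' : Y} {z : ℂ}
    (hh : HasDerivAt h D z) (hG : HasDerivAt G D' z)
    (hor : ∀ᶠ w in 𝓝 z, h w = 0 ∨ h w = G w) : D = 0 ∨ D = D' := by
  by_contra! hne
  have h₁ := hh.eventually_ne (c := 0) hne.1
  have h₂ := (hh.sub hG).eventually_ne (c := 0) (sub_ne_zero.2 hne.2)
  obtain ⟨w, hw₁, hw₂, hw⟩ := (h₁.and (h₂.and (hor.filter_mono nhdsWithin_le_nhds))).exists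
  rcases hw with hw | hw
  · exact hw₁ hw
  · exact hw₂ (by simp [hw])

/-- In an incomplete space the iterated derivative of a holomorphic function may fail to exist, in
which case it has the default value `0`; otherwise it is the one computed in the completion. -/
theorem DifferentiableOn.iteratedDeriv_eq_zero_or_eq_completion
    {X : Type*} [NormedAddCommGroup X] [NormedSpace ℂ X] {S : Set ℂ} (hS : IsOpen S) {g : ℂ → X}
    (hg : DifferentiableOn ℂ g S) (k : ℕ) : ∀ z ∈ S,
      ((iteratedDeriv k g z : X) : UniformSpace.Completion X) = 0 ∨
      ((iteratedDeriv k g z : X) : UniformSpace.Completion X) =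
        iteratedDeriv k (fun w => (g w : UniformSpace.Completion X)) z := by
  let ι : X →L[ℂ] UniformSpace.Completion X := UniformSpace.Completion.toComplL
  have han : AnalyticOnNhd ℂ (fun w => (g w : UniformSpace.Completion X)) S :=
    (ι.differentiable.comp_differentiableOn hg).analyticOnNhd hS
  induction k with
  | zero => exact fun z _ => Or.inr (by simp)
  | succ k ih =>
    intro z hz
    rw [iteratedDeriv_succ, iteratedDeriv_succ]
    by_cases hd : DifferentiableAt ℂ (iteratedDeriv k g) z
    · have hG : DifferentiableAt ℂ
          (iteratedDeriv k fun w => (g w : UniformSpace.Completion X)) z := by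
        rw [iteratedDeriv_eq_iterate]
        exact (han.iterated_deriv k z hz).differentiableAt
      refine HasDerivAt.eq_zero_or_eq_of_eventually_eq_zero_or_eq
        (ι.hasFDerivAt.comp_hasDerivAt z hd.hasDerivAt)
        hG.hasDerivAt ?_
      filter_upwards [hS.mem_nhds hz] with w hw using ih w hw
    · left
      rw [deriv_zero_of_not_differentiableAt hd]
      exact UniformSpace.Completion.coe_zero

/-- Cauchy's estimate for the iterated derivatives, without completeness of the target. -/
theorem DifferentiableOn.norm_iteratedDeriv_le_of_forall_mem_sphere
    {X : Type*} [NormedAddCommGroup X] [NormedSpace ℂ X] {S : Set ℂ} (hS : IsOpen S) {g : ℂ → X}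
    (hg : DifferentiableOn ℂ g S) (k : ℕ) {c : ℂ} {R B : ℝ} (hR : 0 < R)
    (hsub : Metric.closedBall c R ⊆ S) (hB : ∀ z ∈ Metric.sphere c R, ‖g z‖ ≤ B) :
    ‖iteratedDeriv k g c‖ ≤ k.factorial * B / R ^ k := by
  let ι : X →L[ℂ] UniformSpace.Completion X := UniformSpace.Completion.toComplL
  have hd : DifferentiableOn ℂ (fun w => (g w : UniformSpace.Completion X)) S :=
    ι.differentiable.comp_differentiableOn hg
  have hcauchy : ‖iteratedDeriv k (fun w => (g w : UniformSpace.Completion X)) c‖ ≤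
      k.factorial * B / R ^ k := by
    refine Complex.norm_iteratedDeriv_le_of_forall_mem_sphere_norm_le k hR ?_ ?_
    · exact (hd.mono (closure_ball c hR.ne' ▸ hsub)).diffContOnCl
    · intro z hz
      rw [UniformSpace.Completion.norm_coe]
      exact hB z hz
  rw [← UniformSpace.Completion.norm_coe]
  rcases hg.iteratedDeriv_eq_zero_or_eq_completion hS k c
    (hsub (Metric.mem_closedBall_self hR.le)) with h | h
  · rw [h, norm_zero]
    exact (norm_nonneg _).trans hcauchy
  · rwa [h]


/-- If the orbit map of `v` under a strongly continuous representation of `ℝ`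
on a Banach space extends holomorphically to the strip `S_β` with slow growth
of order `N`, i.e. `‖g(it)‖ ≤ C (β - |t|)⁻ᴺ`, then for each `k` the `k`-th
derivative of the extension has slow growth of order `N + k`:
`‖g⁽ᵏ⁾(it)‖ ≤ C_k k! (β - |t|)⁻⁽ᴺ⁺ᵏ⁾`. -/
theorem deriv_slow_growth
    {X : Type*} [NormedAddCommGroup X] [NormedSpace ℂ X]
    (π : ℝ → X →L[ℂ] X)
    (hπ0 : π 0 = 1)
    (hπadd : ∀ s t : ℝ, π (s + t) = π s ∘L π t)
    (hπinv : ∀ t : ℝ, IsUnit (π t))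
    (hπcont : ∀ w : X, Continuous fun t : ℝ => π t w)
    (β C : ℝ) (hβ : 0 < β) (hC : 0 < C) (N : ℕ) (v : X) (g : ℂ → X)
    (hg : DifferentiableOn ℂ g {z : ℂ | |z.im| < β})
    (hgv : ∀ t : ℝ, g t = π t v)
    (hbound : ∀ t : ℝ, |t| < β →
      ‖g (t * Complex.I)‖ ≤ C / (β - |t|) ^ N) :
    ∀ k : ℕ, ∃ Ck : ℝ, 0 < Ck ∧ ∀ t : ℝ, |t| < β →
      ‖iteratedDeriv k g (t * Complex.I)‖ ≤
        Ck * (Nat.factorial k) / (β - |t|) ^ (N + k) := by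
  intro k
  obtain ⟨r, hr, M, hM, hπM⟩ := exists_norm_le_near_zero_of_strongly_continuous π hπadd hπcont
  have hopen := isOpen_abs_im_lt β
  have hequiv : ∀ (s : ℝ) (z : ℂ), |z.im| < β → g (s + z) = π s (g z) := by
    intro s z hz
    refine DifferentiableOn.eqOn_strip_of_eq_real (f := fun z => g (s + z)) hβ
      (hg.comp (by fun_prop) fun z hz => by simpa using hz)
      ((π s).differentiable.comp_differentiableOn hg) (fun t => ?_) hz
    rw [← Complex.ofReal_add, hgv, hπadd, Function.comp_apply, hgv]
    rfl
  obtain ⟨c, hc, hc2, hcr⟩ : ∃ c : ℝ, 0 < c ∧ c ≤ 1 / 2 ∧ c * β ≤ r :=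
    ⟨min (1 / 2) (r / β), by positivity, min_le_left _ _,
      (le_div_iff₀ hβ).1 (min_le_right _ _)⟩
  refine ⟨M * C * 2 ^ N / c ^ k, by positivity, fun t ht => ?_⟩
  set d := β - |t| with hd
  have hd0 : 0 < d := sub_pos.2 ht
  have hdβ : d ≤ β := by linarith [abs_nonneg t]
  have hnear : ∀ z ∈ Metric.closedBall (t * Complex.I) (c * d),
      |z.re| ≤ r ∧ d / 2 ≤ β - |z.im| := by
    intro z hz
    rw [Metric.mem_closedBall, dist_eq_norm] at hz
    have hre := (Complex.abs_re_le_norm _).trans hz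
    have him := (Complex.abs_im_le_norm _).trans hz
    simp only [Complex.sub_re, Complex.sub_im, Complex.re_ofReal_mul, Complex.im_ofReal_mul,
      Complex.I_re, Complex.I_im, mul_zero, mul_one, sub_zero] at hre him
    have h₁ : c * d ≤ c * β := by gcongr
    have h₂ : c * d ≤ 1 / 2 * d := by gcongr
    have h₃ := abs_sub_abs_le_abs_sub z.im t
    exact ⟨by linarith, by linarith⟩
  have hsphere : ∀ z ∈ Metric.sphere (t * Complex.I) (c * d),
      ‖g z‖ ≤ M * (C / (d / 2) ^ N) := by
    intro z hz
    obtain ⟨hre, him⟩ := hnear z (Metric.sphere_subset_closedBall hz)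
    have hz' : |z.im| < β := by linarith
    calc ‖g z‖ = ‖π z.re (g (z.im * Complex.I))‖ := by
          rw [← hequiv _ _ (by simpa using hz'), Complex.re_add_im]
      _ ≤ ‖π z.re‖ * ‖g (z.im * Complex.I)‖ := (π z.re).le_opNorm _
      _ ≤ M * (C / (β - |z.im|) ^ N) := by
          gcongr
          · exact hπM _ hre
          · exact hbound _ hz'
      _ ≤ M * (C / (d / 2) ^ N) := by gcongr
  have hcauchy := hg.norm_iteratedDeriv_le_of_forall_mem_sphere hopen k (mul_pos hc hd0)
    (fun z hz => show |z.im| < β by linarith [(hnear z hz).2]) hsphere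
  refine hcauchy.trans_eq ?_
  rw [div_pow, mul_pow, pow_add]
  field_simp
end

section
/- Let β > 0, n a natural number, C > 0, and let f : [0, β) → ℂ be (n+1)-times continuously differentiable with |f^{(n+1)}(t)| ≤ C·(β − t)^{−n} for all t ∈ [0, β). Then f extends continuously to [0, β]; that is, the limit lim_{t → β⁻} f(t) exists in ℂ. -/
open Set Filter Topology

/-- Mean value inequality for a function differentiable on `[0, β)`: a bound on the norm of the
derivative by `B'` bounds increments by those of `B`. -/
theorem norm_sub_le_sub_of_norm_derivWithin_Ico_le {E : Type*} [NormedAddCommGroup E]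
    [NormedSpace ℝ E] {β : ℝ} {g : ℝ → E} {B B' : ℝ → ℝ}
    (hg : DifferentiableOn ℝ g (Ico 0 β)) (hB : ∀ t ∈ Ico 0 β, HasDerivAt B (B' t) t)
    (hbound : ∀ t ∈ Ico 0 β, ‖derivWithin g (Ico 0 β) t‖ ≤ B' t) {s t : ℝ}
    (hs : 0 ≤ s) (hst : s ≤ t) (ht : t < β) : ‖g t - g s‖ ≤ B t - B s := by
  have hsub : Icc s t ⊆ Ico 0 β := fun x hx => ⟨hs.trans hx.1, hx.2.trans_lt ht⟩
  refine image_norm_le_of_norm_deriv_right_le_deriv_boundary' (f := fun x => g x - g s)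
    (f' := derivWithin g (Ico 0 β)) (B := fun x => B x - B s) (B' := B') (a := s) (b := t)
    ((hg.continuousOn.mono hsub).sub continuousOn_const) (fun x hx => ?_) (by simp)
    (fun x hx => ((hB x (hsub hx)).continuousAt.continuousWithinAt.sub
      continuousWithinAt_const)) (fun x hx => ?_) (fun x hx => hbound x (hsub ⟨hx.1, hx.2.le⟩))
    ⟨hst, le_rfl⟩
  · have hx' := hsub ⟨hx.1, hx.2.le⟩
    refine ((hg x hx').hasDerivWithinAt.mono_of_mem_nhdsWithin ?_).sub_const _
    exact mem_of_superset (Ico_mem_nhdsGE hx'.2) (Ico_subset_Ico_left hx'.1)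
  · exact ((hB x (hsub ⟨hx.1, hx.2.le⟩)).sub_const _).hasDerivWithinAt

theorem hasDerivAt_const_sub_rpow {β t : ℝ} (ht : t < β) (K : ℝ) {a : ℝ} (ha : a ≠ 0) :
    HasDerivAt (fun x => K / a * (β - x) ^ (-a)) (K * (β - t) ^ (-(a + 1))) t := by
  have h := (((hasDerivAt_id t).const_sub β).rpow_const (p := -a)
    (Or.inl (sub_pos.2 ht).ne')).const_mul (K / a)
  refine h.congr_deriv ?_
  rw [show -(a + 1) = -a - 1 by ring]
  simp only [id]
  field_simp

/-- Integrating a bound `K (β - t)^(-(a + 1))` on the derivative, with `0 < a`. -/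
theorem exists_norm_le_rpow_of_norm_derivWithin_le {E : Type*} [NormedAddCommGroup E]
    [NormedSpace ℝ E] {β : ℝ} {g : ℝ → E} {a K : ℝ} (ha : 0 < a)
    (hg : DifferentiableOn ℝ g (Ico 0 β))
    (hbound : ∀ t ∈ Ico 0 β, ‖derivWithin g (Ico 0 β) t‖ ≤ K * (β - t) ^ (-(a + 1))) :
    ∃ K', ∀ t ∈ Ico 0 β, ‖g t‖ ≤ K' * (β - t) ^ (-a) := by
  refine ⟨K / a + (‖g 0‖ + |K / a * β ^ (-a)|) * β ^ a, fun t ht => ?_⟩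
  have h := norm_sub_le_sub_of_norm_derivWithin_Ico_le hg
    (fun x hx => hasDerivAt_const_sub_rpow hx.2 K ha.ne') hbound le_rfl ht.1 ht.2
  have hpos : 0 < β - t := sub_pos.2 ht.2
  have hone : 1 ≤ β ^ a * (β - t) ^ (-a) := by
    rw [Real.rpow_neg hpos.le, ← div_eq_mul_inv, one_le_div (Real.rpow_pos_of_pos hpos a)]
    exact Real.rpow_le_rpow hpos.le (by linarith [ht.1]) ha.le
  have htri := norm_le_norm_add_norm_sub' (g t) (g 0)
  have hneg := neg_abs_le (K / a * β ^ (-a))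
  have hmul := le_mul_of_one_le_right
    (add_nonneg (norm_nonneg (g 0)) (abs_nonneg (K / a * β ^ (-a)))) hone
  simp only [sub_zero] at h
  linarith

theorem exists_norm_derivWithin_le_rpow {E : Type*} [NormedAddCommGroup E]
    [NormedSpace ℝ E] {β : ℝ} {f : ℝ → E} (n : ℕ) {K : ℝ}
    (hf : ContDiffOn ℝ (n + 1) f (Ico 0 β))
    (hbound : ∀ t ∈ Ico 0 β,
      ‖iteratedDerivWithin (n + 1) f (Ico 0 β) t‖ ≤ K * (β - t) ^ (-((n : ℝ) + 1 / 2))) :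
    ∃ K', ∀ t ∈ Ico 0 β, ‖derivWithin f (Ico 0 β) t‖ ≤ K' * (β - t) ^ (-(1 / 2 : ℝ)) := by
  induction n generalizing K with
  | zero => exact ⟨K, by simpa [iteratedDerivWithin_one] using hbound⟩
  | succ n ih =>
    have hdiff : DifferentiableOn ℝ (iteratedDerivWithin (n + 1) f (Ico 0 β)) (Ico 0 β) :=
      hf.differentiableOn_iteratedDerivWithin (by norm_cast; lia) (uniqueDiffOn_Ico 0 β)
    obtain ⟨K', hK'⟩ := exists_norm_le_rpow_of_norm_derivWithin_le (K := K)
      (a := (n : ℝ) + 1 / 2) (by positivity) hdiff fun t ht => by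
        have h := hbound t ht
        rw [iteratedDerivWithin_succ] at h
        convert h using 3
        push_cast
        ring
    exact ih (hf.of_le (by norm_cast; lia)) hK'

theorem exists_tendsto_of_norm_derivWithin_Ico_le {E : Type*} [NormedAddCommGroup E]
    [NormedSpace ℝ E] [CompleteSpace E] {β : ℝ} (hβ : 0 < β) {g : ℝ → E} {B B' : ℝ → ℝ}
    (hg : DifferentiableOn ℝ g (Ico 0 β)) (hB : ∀ t ∈ Ico 0 β, HasDerivAt B (B' t) t)
    (hcont : ContinuousAt B β)
    (hbound : ∀ t ∈ Ico 0 β, ‖derivWithin g (Ico 0 β) t‖ ≤ B' t) :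
    ∃ L, Tendsto g (𝓝[Ico 0 β] β) (𝓝 L) := by
  have : (𝓝[Ico 0 β] β).NeBot := by
    rw [← mem_closure_iff_nhdsWithin_neBot, closure_Ico hβ.ne]
    exact right_mem_Icc.2 hβ.le
  have hdist : ∀ s ∈ Ico 0 β, ∀ t ∈ Ico 0 β, dist (g s) (g t) ≤ dist (B s) (B t) := by
    intro s hs t ht
    wlog hst : s ≤ t generalizing s t
    · rw [dist_comm, dist_comm (B s)]
      exact this t ht s hs (le_of_not_ge hst)
    rw [dist_comm, dist_comm (B s), dist_eq_norm, Real.dist_eq]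
    exact (norm_sub_le_sub_of_norm_derivWithin_Ico_le hg hB hbound hs.1 hst ht.2).trans
      (le_abs_self _)
  refine cauchy_map_iff_exists_tendsto.1 (Metric.cauchy_iff.2 ⟨inferInstance, fun ε hε => ?_⟩)
  have hBc : Cauchy (map B (𝓝[Ico 0 β] β)) :=
    (hcont.tendsto.mono_left nhdsWithin_le_nhds).cauchy_map
  obtain ⟨u, hu, hu'⟩ := (Metric.cauchy_iff.1 hBc).2 ε hε
  refine ⟨g '' (B ⁻¹' u ∩ Ico 0 β), image_mem_map (inter_mem hu self_mem_nhdsWithin), ?_⟩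
  rintro _ ⟨s, ⟨hsu, hs⟩, rfl⟩ _ ⟨t, ⟨htu, ht⟩, rfl⟩
  exact (hdist s hs t ht).trans_lt (hu' _ hsu _ htu)

/-- A `C^{n+1}` function on `[0, β)` whose `(n+1)`-st derivative blows up at
most like `(β - t)⁻ⁿ` at the right endpoint extends continuously to `[0, β]`,
i.e. the limit `lim_{t → β⁻} f(t)` exists. -/
theorem extends_continuously_of_deriv_bound
    (β : ℝ) (hβ : 0 < β) (n : ℕ) (C : ℝ) (hC : 0 < C) (f : ℝ → ℂ)
    (hf : ContDiffOn ℝ (n + 1) f (Set.Ico 0 β))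
    (hbound : ∀ t ∈ Set.Ico (0 : ℝ) β,
      ‖iteratedDerivWithin (n + 1) f (Set.Ico 0 β) t‖ ≤ C / (β - t) ^ n) :
    ∃ L : ℂ, Filter.Tendsto f (nhdsWithin β (Set.Ico 0 β)) (nhds L) := by
  obtain ⟨K, hK⟩ := exists_norm_derivWithin_le_rpow n (K := C * β ^ (1 / 2 : ℝ)) hf
    fun t ht => (hbound t ht).trans <| by
      have hpos : 0 < β - t := sub_pos.2 ht.2
      have hle : (β - t) ^ (1 / 2 : ℝ) ≤ β ^ (1 / 2 : ℝ) :=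
        Real.rpow_le_rpow hpos.le (by linarith [ht.1]) (by norm_num)
      rw [Real.rpow_neg hpos.le, Real.rpow_add hpos, Real.rpow_natCast, ← div_eq_mul_inv,
        div_le_div_iff₀ (by positivity) (by positivity)]
      calc C * ((β - t) ^ n * (β - t) ^ (1 / 2 : ℝ))
          ≤ C * ((β - t) ^ n * β ^ (1 / 2 : ℝ)) := by gcongr
        _ = C * β ^ (1 / 2 : ℝ) * (β - t) ^ n := by ring
  refine exists_tendsto_of_norm_derivWithin_Ico_le hβ
    (hf.differentiableOn (by norm_cast))
    (B := fun x => K / (-(1 / 2)) * (β - x) ^ (-(-(1 / 2 : ℝ))))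
    (fun t ht => hasDerivAt_const_sub_rpow ht.2 K (by norm_num)) ?_ fun t ht => ?_
  · exact ((continuous_const.sub continuous_id).rpow_const
      fun _ => Or.inr (by norm_num)).continuousAt.const_mul _
  · convert hK t ht using 3
    norm_num
end

section
/- Let d ≥ 1, let Ω ⊆ ℝ^d be a nonempty open convex set, and let T_Ω := {z ∈ ℂ^d : Im z ∈ Ω} be the tube over Ω. Suppose F : ℂ^d × ℂ^d → ℂ is holomorphic on the open set T_Ω × T_Ω ⊆ ℂ^{2d} and satisfies the translation invariance F(z + x, w + x) = F(z, w) for all real vectors x ∈ ℝ^d and all z, w ∈ T_Ω. Then there exists a function G : ℂ^d → ℂ, holomorphic on the tube T_{Ω−Ω} over the convex open set Ω − Ω := {y − y' : y, y' ∈ Ω}, such that F(z, w) = G(w − z) for all z, w ∈ T_Ω. -/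
open scoped Pointwise

/-- The tube over an open set is open. -/
theorem isOpen_tube {ι : Type*} {Ω : Set (ι → ℝ)} (hopen : IsOpen Ω) :
    IsOpen {z : ι → ℂ | (fun i => (z i).im) ∈ Ω} :=
  hopen.preimage (continuous_pi fun i => Complex.continuous_im.comp (continuous_apply i))

/-- The tube over a convex set is convex. -/
theorem convex_tube {ι : Type*} {Ω : Set (ι → ℝ)} (hconv : Convex ℝ Ω) :
    Convex ℝ {z : ι → ℂ | (fun i => (z i).im) ∈ Ω} := by
  refine hconv.is_linear_preimage (f := fun (z : ι → ℂ) i => (z i).im) ⟨?_, ?_⟩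
  · intro z w
    ext i
    simp
  · intro c z
    ext i
    simp

/-- A complex-linear map on `ℂ^ι` that vanishes on real vectors is zero. -/
theorem ContinuousLinearMap.eq_zero_of_forall_ofReal {ι : Type*} {E : Type*}
    [NormedAddCommGroup E] [NormedSpace ℂ E] (L : (ι → ℂ) →L[ℂ] E)
    (hL : ∀ x : ι → ℝ, L (fun i => (x i : ℂ)) = 0) : L = 0 := by
  ext v
  have hv : v = (fun i => ((v i).re : ℂ)) + Complex.I • fun i => ((v i).im : ℂ) := by
    ext i
    simp [mul_comm Complex.I, Complex.re_add_im]
  rw [hv, map_add, map_smul, hL fun i => (v i).re, hL fun i => (v i).im]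
  simp

/-- A holomorphic function on a convex open subset of `ℂ^ι` that is invariant under all
real translations is constant. -/
theorem eq_of_differentiableOn_of_real_translation_invariant {ι : Type*} [Fintype ι]
    {E : Type*} [NormedAddCommGroup E] [NormedSpace ℂ E] {D : Set (ι → ℂ)}
    (hD : IsOpen D) (hDc : Convex ℝ D) {H : (ι → ℂ) → E} (hH : DifferentiableOn ℂ H D)
    (hinv : ∀ (x : ι → ℝ), ∀ z ∈ D, H (z + fun i => (x i : ℂ)) = H z)
    {z w : ι → ℂ} (hz : z ∈ D) (hw : w ∈ D) : H z = H w := by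
  refine hD.is_const_of_fderiv_eq_zero hDc.isPreconnected hH (fun p hp => ?_) hz hw
  refine ContinuousLinearMap.eq_zero_of_forall_ofReal _ fun x => ?_
  have hline := ((hH.differentiableAt (hD.mem_nhds hp)).hasFDerivAt.restrictScalars
    ℝ).hasLineDerivAt (fun i => (x i : ℂ))
  have hconst : HasLineDerivAt ℝ H 0 p (fun i => (x i : ℂ)) := by
    refine (hasDerivAt_const (0 : ℝ) (H p)).congr_of_eventuallyEq (.of_forall fun t => ?_)
    refine (congrArg (fun v => H (p + v)) ?_).trans (hinv (fun i => t * x i) p hp)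
    ext i
    simp
  exact hline.unique hconst

/-- A holomorphic kernel `F` on the product of two copies of the tube
`T_Ω = {z ∈ ℂ^d : Im z ∈ Ω}` over a nonempty open convex set `Ω ⊆ ℝ^d` which is
invariant under simultaneous real translations factors through a holomorphic
function `G` on the tube over `Ω - Ω`, via `F(z, w) = G(w - z)`. -/
theorem invariant_kernel_factors
    (d : ℕ) (hd : 1 ≤ d) (Ω : Set (Fin d → ℝ))
    (hne : Ω.Nonempty) (hopen : IsOpen Ω) (hconv : Convex ℝ Ω)
    (F : (Fin d → ℂ) × (Fin d → ℂ) → ℂ)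
    (hF : DifferentiableOn ℂ F
      ({z : Fin d → ℂ | (fun i => (z i).im) ∈ Ω} ×ˢ
        {z : Fin d → ℂ | (fun i => (z i).im) ∈ Ω}))
    (hinv : ∀ (x : Fin d → ℝ) (z w : Fin d → ℂ),
      (fun i => (z i).im) ∈ Ω → (fun i => (w i).im) ∈ Ω →
      F (z + fun i => (x i : ℂ), w + fun i => (x i : ℂ)) = F (z, w)) :
    ∃ G : (Fin d → ℂ) → ℂ,
      DifferentiableOn ℂ G {z : Fin d → ℂ | (fun i => (z i).im) ∈ Ω - Ω} ∧
      ∀ z w : Fin d → ℂ,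
        (fun i => (z i).im) ∈ Ω → (fun i => (w i).im) ∈ Ω →
        F (z, w) = G (w - z) := by
  set T : Set (Fin d → ℂ) := {z | (fun i => (z i).im) ∈ Ω} with hT
  have hTo : IsOpen T := isOpen_tube hopen
  have hTc : Convex ℝ T := convex_tube hconv
  have hT_add : ∀ (x : Fin d → ℝ), ∀ z ∈ T, z + (fun i => (x i : ℂ)) ∈ T := by
    intro x z hz
    simpa [hT] using hz
  have hFd : ∀ z ∈ T, ∀ w ∈ T, DifferentiableAt ℂ F (z, w) := fun z hz w hw =>
    hF.differentiableAt ((hTo.prod hTo).mem_nhds ⟨hz, hw⟩)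
  have key : ∀ u z z' : Fin d → ℂ, z ∈ T → z + u ∈ T → z' ∈ T → z' + u ∈ T →
      F (z, z + u) = F (z', z' + u) := by
    intro u z z' hz hzu hz' hzu'
    refine eq_of_differentiableOn_of_real_translation_invariant
      (D := T ∩ (fun z => z + u) ⁻¹' T) (H := fun z => F (z, z + u))
      (hTo.inter (hTo.preimage (by fun_prop))) (hTc.inter (hTc.translate_preimage_left u))
      ?_ ?_ ⟨hz, hzu⟩ ⟨hz', hzu'⟩
    · rintro p ⟨hp, hpu⟩
      exact ((hFd p hp (p + u) hpu).comp p
        (f := fun z => (z, z + u)) (by fun_prop)).differentiableWithinAt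
    · rintro x p ⟨hp, hpu⟩
      simpa only [add_right_comm] using hinv x p (p + u) hp hpu
  classical
  let G : (Fin d → ℂ) → ℂ := fun u =>
    if h : ∃ z, z ∈ T ∧ z + u ∈ T then F (h.choose, h.choose + u) else 0
  have hG : ∀ u z : Fin d → ℂ, z ∈ T → z + u ∈ T → G u = F (z, z + u) := by
    intro u z hz hzu
    have h : ∃ z, z ∈ T ∧ z + u ∈ T := ⟨z, hz, hzu⟩
    simp only [G, dif_pos h]
    exact key u _ z h.choose_spec.1 h.choose_spec.2 hz hzu
  refine ⟨G, ?_, fun z w hz hw => ?_⟩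
  · rintro u ⟨a, ha, b, hb, hab⟩
    obtain ⟨z, hz, hzu⟩ : ∃ z, z ∈ T ∧ z + u ∈ T := by
      refine ⟨fun i => (b i : ℂ) * Complex.I, by simpa [hT] using hb, ?_⟩
      have : (fun i => b i + (u i).im) = a := by
        ext i
        have := congrFun hab i
        simp only [Pi.sub_apply] at this
        linarith
      simpa [hT, this] using ha
    have hev : G =ᶠ[nhds u] fun u => F (z, z + u) := by
      filter_upwards [(hTo.preimage (f := fun u => z + u) (by fun_prop)).mem_nhds hzu]
        with v hv using hG v z hz hv
    exact (((hFd z hz (z + u) hzu).comp u (f := fun u => (z, z + u))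
      (by fun_prop)).congr_of_eventuallyEq hev).differentiableWithinAt
  · rw [hG (w - z) z hz (by rwa [add_sub_cancel]), add_sub_cancel]
end
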